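/- Let 1 ≤ p < ∞ and let f ∈ U_p(ℝ²), so that in particular f ∈ S₀(ℝ²). Then there is a constant c depending only on p such that for every t > 0, f*(t) − f*(2t) ≤ c t^{1/(2p)} ( φ₁*(√t / 2) + φ₂*(√t / 2) ), where φ₁(y) = ‖f_y‖*_{Lip 1/p} and φ₂(x) = ‖f_x‖*_{Lip 1/p}. -/

import Mathlib

open MeasureTheory Set
open scoped ENNReal

noncomputable section

/-- Extended essential sup norm on ℝ. -/
def einf (φ : ℝ → ℝ) : ℝ≥0∞ := eLpNorm φ ⊤ volume

/-- Lipschitz `α` seminorm (extended real valued):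
`sup_{h>0} h^{-α} ‖φ(·+h) - φ‖_∞`. -/
def lipSemiE (α : ℝ) (φ : ℝ → ℝ) : ℝ≥0∞ :=
  ⨆ h ∈ Ioi (0:ℝ), ENNReal.ofReal (h ^ (-α)) * einf (fun x => φ (x + h) - φ x)

/-- Real-valued Lipschitz `α` seminorm `‖φ‖*_{Lip α}`. -/
def lipSemi (α : ℝ) (φ : ℝ → ℝ) : ℝ := (lipSemiE α φ).toReal

/-- `φ ∈ Lip α`: essentially bounded with finite Lipschitz `α` seminorm. -/
def MemLip (α : ℝ) (φ : ℝ → ℝ) : Prop := einf φ < ⊤ ∧ lipSemiE α φ < ⊤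

/-- `‖φ‖_{Lip α} = ‖φ‖_∞ + ‖φ‖*_{Lip α}`. -/
def lipNorm (α : ℝ) (φ : ℝ → ℝ) : ℝ := (einf φ + lipSemiE α φ).toReal

/-- The class `S₀`: measurable functions with finite distribution function at every
positive level. -/
def S0 {X : Type*} [MeasureSpace X] (f : X → ℝ) : Prop :=
  Measurable f ∧ ∀ s : ℝ, 0 < s → volume {x | s < |f x|} < ⊤

/-- The non-increasing rearrangement `f*`. -/
def rearr {X : Type*} [MeasureSpace X] (f : X → ℝ) (t : ℝ) : ℝ :=
  sInf {s : ℝ | 0 ≤ s ∧ volume {x | s < |f x|} ≤ ENNReal.ofReal t}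

/-- `f**(t) = (1/t) ∫₀^t f*(u) du`. -/
def doubleStar {X : Type*} [MeasureSpace X] (f : X → ℝ) (t : ℝ) : ℝ :=
  (∫ u in Ioc (0:ℝ) t, rearr f u) / t

/-- Lorentz `L^{p,q}` norm. -/
def lorentzNorm {X : Type*} [MeasureSpace X] (p q : ℝ) (f : X → ℝ) : ℝ :=
  (∫ t in Ioi (0:ℝ), (t ^ (1/p) * rearr f t) ^ q / t) ^ (1/q)

/-- Membership in the Lorentz space `L^{p,q}`. -/
def MemLorentz {X : Type*} [MeasureSpace X] (p q : ℝ) (f : X → ℝ) : Prop :=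
  S0 f ∧ IntegrableOn (fun t => (t ^ (1/p) * rearr f t) ^ q / t) (Ioi (0:ℝ))

/-- The space `U_p(ℝ²)`: a.e. sections in `Lip (1/p)`, with `Lip (1/p)` norms of the
sections in `L^{p,1}(ℝ)`. -/
def MemUp (p : ℝ) (f : ℝ × ℝ → ℝ) : Prop :=
  Measurable f ∧
  (∀ᵐ y : ℝ ∂volume, MemLip (1/p) (fun x => f (x, y))) ∧
  (∀ᵐ x : ℝ ∂volume, MemLip (1/p) (fun y => f (x, y))) ∧
  MemLorentz p 1 (fun y => lipNorm (1/p) (fun x => f (x, y))) ∧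
  MemLorentz p 1 (fun x => lipNorm (1/p) (fun y => f (x, y)))

/-- The Steklov-type average `f_h`. -/
def avg (f : ℝ × ℝ → ℝ) (h : ℝ) (z : ℝ × ℝ) : ℝ :=
  (∫ u in Ioc (0:ℝ) h, ∫ v in Ioc (0:ℝ) h, f (z.1 + u, z.2 + v)) / h ^ 2

lemma rearr_nonneg {X : Type*} [MeasureSpace X] (f : X → ℝ) (t : ℝ) : 0 ≤ rearr f t :=
  Real.sInf_nonneg fun _ hs => hs.1

lemma lt_volume_of_lt_rearr {X : Type*} [MeasureSpace X] {f : X → ℝ} {t a : ℝ}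
    (ha : 0 ≤ a) (h : a < rearr f t) : ENNReal.ofReal t < volume {x | a < |f x|} := by
  by_contra! hle
  have hbdd : BddBelow {s : ℝ | 0 ≤ s ∧ volume {x | s < |f x|} ≤ ENNReal.ofReal t} :=
    ⟨0, fun _ hs => hs.1⟩
  have hmem : a ∈ {s : ℝ | 0 ≤ s ∧ volume {x | s < |f x|} ≤ ENNReal.ofReal t} := ⟨ha, hle⟩
  exact absurd (csInf_le hbdd hmem) (not_le.mpr h)

lemma volume_le_of_rearr_lt {X : Type*} [MeasureSpace X] {f : X → ℝ} {t b : ℝ}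
    (hne : {s : ℝ | 0 ≤ s ∧ volume {x | s < |f x|} ≤ ENNReal.ofReal t}.Nonempty)
    (h : rearr f t < b) : volume {x | b < |f x|} ≤ ENNReal.ofReal t := by
  obtain ⟨s, hs, hsb⟩ := exists_lt_of_csInf_lt hne h
  exact (measure_mono fun x (hx : b < |f x|) => hsb.trans hx).trans hs.2

/-- A function with finite distribution function has arbitrarily small superlevel sets. -/
lemma S0.exists_volume_le {X : Type*} [MeasureSpace X] {f : X → ℝ} (hf : S0 f) {t : ℝ}
    (ht : 0 < t) :
    {s : ℝ | 0 ≤ s ∧ volume {x | s < |f x|} ≤ ENNReal.ofReal t}.Nonempty := by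
  have hlim : Filter.Tendsto (fun n : ℕ => volume {x | (n : ℝ) + 1 < |f x|}) Filter.atTop
      (nhds (volume (⋂ n : ℕ, {x | (n : ℝ) + 1 < |f x|}))) := by
    refine tendsto_measure_iInter_atTop
      (fun n => (measurableSet_lt measurable_const hf.1.abs).nullMeasurableSet) ?_
      ⟨0, (hf.2 _ (by positivity)).ne⟩
    intro m n hmn x hx
    have : (m : ℝ) ≤ n := by exact_mod_cast hmn
    simp only [mem_ofPred_eq] at hx ⊢
    linarith
  have hempty : (⋂ n : ℕ, {x | (n : ℝ) + 1 < |f x|}) = ∅ := by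
    ext x
    simp only [mem_iInter, mem_ofPred_eq, mem_empty_iff_false, iff_false, not_forall, not_lt]
    obtain ⟨n, hn⟩ := exists_nat_ge |f x|
    exact ⟨n, by linarith⟩
  rw [hempty, measure_empty] at hlim
  obtain ⟨n, hn⟩ := (hlim.eventually_lt_const (ENNReal.ofReal_pos.mpr ht)).exists
  exact ⟨n + 1, by positivity, hn.le⟩

lemma abs_lipSemi_le_abs_lipNorm {α : ℝ} {φ : ℝ → ℝ} (h : MemLip α φ) :
    |lipSemi α φ| ≤ |lipNorm α φ| := by
  rw [lipSemi, lipNorm, abs_of_nonneg ENNReal.toReal_nonneg,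
    abs_of_nonneg ENNReal.toReal_nonneg]
  exact ENNReal.toReal_mono (ENNReal.add_lt_top.mpr h).ne le_add_self

lemma ae_abs_sub_le_of_lipSemiE_le {α M h : ℝ} {φ : ℝ → ℝ} (hM : 0 ≤ M)
    (hφ : lipSemiE α φ ≤ ENNReal.ofReal M) (hh : 0 < h) :
    ∀ᵐ x : ℝ, |φ (x + h) - φ x| ≤ M * h ^ α := by
  have h1 : ENNReal.ofReal (h ^ (-α)) * einf (fun x => φ (x + h) - φ x) ≤ ENNReal.ofReal M :=
    (le_iSup₂ (f := fun h (_ : h ∈ Ioi (0 : ℝ)) =>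
      ENNReal.ofReal (h ^ (-α)) * einf (fun x => φ (x + h) - φ x)) h hh).trans hφ
  have hbound : ∀ᵐ x : ℝ, ‖φ (x + h) - φ x‖ₑ ≤ einf (fun x => φ (x + h) - φ x) := by
    simpa only [einf, eLpNorm_exponent_top] using
      enorm_ae_le_eLpNormEssSup (fun x => φ (x + h) - φ x) volume
  filter_upwards [hbound] with x hx
  have h2 : ENNReal.ofReal (h ^ (-α) * |φ (x + h) - φ x|) ≤ ENNReal.ofReal M := by
    rw [ENNReal.ofReal_mul (by positivity), ← Real.norm_eq_abs, ofReal_norm]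
    exact (mul_le_mul_right hx _).trans h1
  have h3 := (ENNReal.ofReal_le_ofReal_iff hM).mp h2
  have hpos : 0 < h ^ α := by positivity
  rwa [Real.rpow_neg hh.le, inv_mul_le_iff₀ hpos, mul_comm] at h3

/-- If a Lipschitz function drops below `b` on every interval of length `L`, it essentially
never exceeds `b` by more than its oscillation over distance `L`. -/
lemma volume_superlevel_eq_zero {α M L a b : ℝ} {φ : ℝ → ℝ} (hφm : Measurable φ)
    (hα : 0 < α) (hM : 0 ≤ M) (hφ : lipSemiE α φ ≤ ENNReal.ofReal M)
    (hb : volume {x | b < |φ x|} < ENNReal.ofReal L) (hab : M * L ^ α < a - b) :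
    volume {x | a < |φ x|} = 0 := by
  have hmeas : MeasurableSet {z : ℝ × ℝ | 0 < z.2 → |φ (z.1 + z.2) - φ z.1| ≤ M * z.2 ^ α} := by
    refine MeasurableSet.imp (measurableSet_lt measurable_const measurable_snd) ?_
    refine measurableSet_le ?_ ?_
    · exact ((hφm.comp (measurable_fst.add measurable_snd)).sub (hφm.comp measurable_fst)).abs
    · exact (measurable_snd.pow_const α).const_mul M
  have hae : ∀ᵐ x : ℝ, ∀ᵐ h : ℝ, 0 < h → |φ (x + h) - φ x| ≤ M * h ^ α := by
    refine (Measure.ae_ae_comm hmeas).mpr (Filter.Eventually.of_forall fun h => ?_)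
    by_cases hh : 0 < h
    · filter_upwards [ae_abs_sub_le_of_lipSemiE_le hM hφ hh] with x hx _ using hx
    · exact Filter.Eventually.of_forall fun x h0 => absurd h0 hh
  rw [measure_eq_zero_iff_ae_notMem]
  filter_upwards [hae] with x hx hxa
  refine absurd hb (not_lt.mpr ?_)
  calc ENNReal.ofReal L = volume (Ioo 0 L) := by rw [Real.volume_Ioo, sub_zero]
    _ ≤ volume ((fun h => x + h) ⁻¹' {x | b < |φ x|}) := by
        refine measure_mono_ae ?_
        filter_upwards [hx] with h hh hmem
        have h1 := hh hmem.1
        have h2 : M * h ^ α ≤ M * L ^ α :=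
          mul_le_mul_of_nonneg_left (Real.rpow_le_rpow hmem.1.le hmem.2.le hα.le) hM
        have h3 := abs_sub_abs_le_abs_sub (φ x) (φ (x + h))
        rw [abs_sub_comm] at h3
        change b < |φ (x + h)|
        change a < |φ x| at hxa
        linarith
    _ = volume {x | b < |φ x|} := measure_preimage_add _ _ _

/-- Outside of a small set of horizontal lines, `|f|` essentially does not exceed `a`. -/
lemma exists_exceptional_lines {α M s a b : ℝ} {f : ℝ × ℝ → ℝ} (hf : Measurable f)
    (hα : 0 < α) (hM : 0 ≤ M) (hs : 0 < s)
    (hlip : ∀ᵐ y : ℝ, MemLip α (fun x => f (x, y)))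
    (hφ : volume {y : ℝ | M < |lipSemi α (fun x => f (x, y))|} ≤ ENNReal.ofReal (s / 2))
    (hb : volume {z | b < |f z|} ≤ ENNReal.ofReal (2 * s ^ 2))
    (hab : M * (5 * s) ^ α < a - b) :
    ∃ G : Set ℝ, volume G ≤ ENNReal.ofReal s ∧ ∀ᵐ z : ℝ × ℝ, a < |f z| → z.2 ∈ G := by
  have hB : MeasurableSet {z | b < |f z|} := measurableSet_lt measurable_const hf.abs
  set E := toMeasurable volume {y : ℝ | M < |lipSemi α (fun x => f (x, y))|} with hE
  have hEm : MeasurableSet E := measurableSet_toMeasurable _ _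
  set P : Set ℝ := {y | ENNReal.ofReal (4 * s) ≤ volume ((fun x => (x, y)) ⁻¹' {z | b < |f z|})}
    with hP
  have hPm : MeasurableSet P := measurableSet_le measurable_const (measurable_measure_prodMk_right hB)
  have hPv : volume P ≤ ENNReal.ofReal (s / 2) := by
    have h1 := mul_meas_ge_le_lintegral (μ := (volume : Measure ℝ))
      (measurable_measure_prodMk_right (μ := (volume : Measure ℝ)) hB) (ENNReal.ofReal (4 * s))
    rw [← Measure.prod_apply_symm hB] at h1
    have h2 : ENNReal.ofReal (4 * s) * volume P
        ≤ ENNReal.ofReal (4 * s) * ENNReal.ofReal (s / 2) := by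
      refine (h1.trans hb).trans (le_of_eq ?_)
      rw [← ENNReal.ofReal_mul (by positivity)]
      congr 1
      ring
    exact (ENNReal.mul_le_mul_iff_right (ENNReal.ofReal_pos.mpr (by positivity)).ne'
      ENNReal.ofReal_ne_top).mp h2
  refine ⟨E ∪ P, ?_, ?_⟩
  · refine (measure_union_le _ _).trans ?_
    refine (add_le_add ((measure_toMeasurable _).trans_le hφ) hPv).trans (le_of_eq ?_)
    rw [← ENNReal.ofReal_add (by positivity) (by positivity), add_halves]
  have hSm : MeasurableSet {z : ℝ × ℝ | a < |f z| → z.2 ∈ E ∪ P} :=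
    MeasurableSet.imp (measurableSet_lt measurable_const hf.abs)
      (measurable_snd (hEm.union hPm))
  rw [Measure.volume_eq_prod, Measure.ae_prod_iff_ae_ae hSm]
  refine (Measure.ae_ae_comm hSm).mpr ?_
  filter_upwards [hlip] with y hy
  by_cases hyG : y ∈ E ∪ P
  · exact Filter.Eventually.of_forall fun x _ => hyG
  have hyE : ¬ M < |lipSemi α (fun x => f (x, y))| := fun h =>
    hyG (Or.inl (subset_toMeasurable _ _ h))
  have hyP : volume ((fun x => (x, y)) ⁻¹' {z | b < |f z|}) < ENNReal.ofReal (4 * s) :=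
    not_le.mp fun h => hyG (Or.inr h)
  have hlipM : lipSemiE α (fun x => f (x, y)) ≤ ENNReal.ofReal M := by
    rw [← ENNReal.ofReal_toReal hy.2.ne]
    exact ENNReal.ofReal_le_ofReal ((le_abs_self _).trans (not_lt.mp hyE))
  have h0 := volume_superlevel_eq_zero (hf.comp measurable_prodMk_right) hα hM hlipM
    (hyP.trans_le (ENNReal.ofReal_le_ofReal (by linarith : 4 * s ≤ 5 * s))) hab
  filter_upwards [measure_eq_zero_iff_ae_notMem.mp h0] with x hx hxa
  exact absurd hxa hx

lemma nonempty_lipSemi_levels {p t : ℝ} (ht : 0 < t) {F : ℝ → ℝ → ℝ}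
    (hlip : ∀ᵐ y : ℝ, MemLip (1 / p) (F y)) (hN : S0 fun y => lipNorm (1 / p) (F y)) :
    {s : ℝ | 0 ≤ s ∧
      volume {y : ℝ | s < |lipSemi (1 / p) (F y)|} ≤ ENNReal.ofReal t}.Nonempty := by
  obtain ⟨s, hs0, hs⟩ := hN.exists_volume_le ht
  refine ⟨s, hs0, le_trans (measure_mono_ae ?_) hs⟩
  filter_upwards [hlip] with y hy hmem
  exact lt_of_lt_of_le hmem (abs_lipSemi_le_abs_lipNorm hy)

/-- If `1 ≤ p < ∞` and `f ∈ U_p(ℝ²)`, then for every `t > 0`,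
`f*(t) - f*(2t) ≤ c t^{1/(2p)} (φ₁*(√t/2) + φ₂*(√t/2))` with `c = c(p)`. -/
theorem stmt2 (p : ℝ) (hp : 1 ≤ p) :
    ∃ c : ℝ, 0 < c ∧ ∀ f : ℝ × ℝ → ℝ, MemUp p f → ∀ t : ℝ, 0 < t →
      rearr f t - rearr f (2 * t) ≤
        c * t ^ (1 / (2 * p)) *
          (rearr (fun y => lipSemi (1/p) (fun x => f (x, y))) (Real.sqrt t / 2) +
           rearr (fun x => lipSemi (1/p) (fun y => f (x, y))) (Real.sqrt t / 2)) := by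
  have hp0 : 0 < p := by linarith
  have hα : 0 < 1 / p := by positivity
  refine ⟨5 ^ (1 / p), by positivity, ?_⟩
  rintro f ⟨hf, hlip1, hlip2, ⟨hN1, -⟩, ⟨hN2, -⟩⟩ t ht
  set s := Real.sqrt t with hs_def
  have hs : 0 < s := Real.sqrt_pos.mpr ht
  have hst : s ^ 2 = t := Real.sq_sqrt ht.le
  have hK : (5 : ℝ) ^ (1 / p) * t ^ (1 / (2 * p)) = (5 * s) ^ (1 / p) := by
    rw [Real.mul_rpow (by norm_num) hs.le, hs_def, Real.sqrt_eq_rpow, ← Real.rpow_mul ht.le]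
    congr 2
    field_simp
  rw [hK]
  have hne1 := nonempty_lipSemi_levels (half_pos hs) (F := fun y x => f (x, y)) hlip1 hN1
  have hne2 := nonempty_lipSemi_levels (half_pos hs) (F := fun x y => f (x, y)) hlip2 hN2
  set A := rearr (fun y => lipSemi (1 / p) (fun x => f (x, y))) (s / 2) with hA
  set B := rearr (fun x => lipSemi (1 / p) (fun y => f (x, y))) (s / 2) with hB
  have hA0 : 0 ≤ A := rearr_nonneg _ _
  have hB0 : 0 ≤ B := rearr_nonneg _ _
  set K := (5 * s) ^ (1 / p) with hKdef
  have hK0 : 0 < K := by positivity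
  by_contra! hlt
  have hb0 : 0 ≤ rearr f (2 * t) := rearr_nonneg _ _
  have hKAB : 0 ≤ K * (A + B) := by positivity
  have hne : {s : ℝ | 0 ≤ s ∧ volume {x | s < |f x|} ≤ ENNReal.ofReal (2 * t)}.Nonempty := by
    rw [nonempty_iff_ne_empty]
    intro hemp
    have hempt : {s : ℝ | 0 ≤ s ∧ volume {x | s < |f x|} ≤ ENNReal.ofReal t} = ∅ :=
      eq_empty_of_forall_notMem fun r hr => notMem_empty r <| hemp ▸
        (show r ∈ {s : ℝ | 0 ≤ s ∧ volume {x | s < |f x|} ≤ ENNReal.ofReal (2 * t)} from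
          ⟨hr.1, hr.2.trans (ENNReal.ofReal_le_ofReal (by linarith))⟩)
    have h0 : rearr f t = 0 := by rw [rearr, hempt, Real.sInf_empty]
    linarith
  obtain ⟨ε, hε, hεK⟩ : ∃ ε > 0, K * (A + B) + (K + 2) * ε < rearr f t - rearr f (2 * t) := by
    refine ⟨(rearr f t - rearr f (2 * t) - K * (A + B)) / (2 * (K + 2)),
      div_pos (by linarith) (by positivity), ?_⟩
    have : (K + 2) * ((rearr f t - rearr f (2 * t) - K * (A + B)) / (2 * (K + 2))) =
        (rearr f t - rearr f (2 * t) - K * (A + B)) / 2 := by field_simp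
    linarith
  have hKε : 0 < K * ε := by positivity
  have hKA : 0 ≤ K * A := by positivity
  have hKB : 0 ≤ K * B := by positivity
  have ha := lt_volume_of_lt_rearr (f := f) (t := t) (a := rearr f t - ε) (by linarith)
    (by linarith)
  have hb : volume {z | rearr f (2 * t) + ε < |f z|} ≤ ENNReal.ofReal (2 * s ^ 2) := by
    rw [hst]
    exact volume_le_of_rearr_lt hne (by linarith)
  have hswap : MeasurePreserving Prod.swap (volume : Measure (ℝ × ℝ)) volume :=
    Measure.measurePreserving_swap
  obtain ⟨G, hG, hGz⟩ := exists_exceptional_lines (a := rearr f t - ε) hf hα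
    (by linarith : 0 ≤ A + ε) hs hlip1 (volume_le_of_rearr_lt hne1 (lt_add_of_pos_right A hε))
    hb (by rw [← hKdef]; linarith)
  obtain ⟨H, hH, hHz⟩ := exists_exceptional_lines (a := rearr f t - ε)
    (hf.comp measurable_swap) hα
    (by linarith : 0 ≤ B + ε) hs hlip2 (volume_le_of_rearr_lt hne2 (lt_add_of_pos_right B hε))
    (by
      have := hswap.measure_preimage
        (measurableSet_lt measurable_const hf.abs).nullMeasurableSet
        (s := {z | rearr f (2 * t) + ε < |f z|})
      exact this.trans_le hb)
    (by rw [← hKdef]; linarith)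
  have hHz' := hswap.quasiMeasurePreserving.ae hHz
  refine absurd ha (not_lt.mpr ?_)
  calc volume {z | rearr f t - ε < |f z|} ≤ volume (H ×ˢ G) := by
        refine measure_mono_ae ?_
        filter_upwards [hGz, hHz'] with z h1 h2 hz
        exact ⟨h2 hz, h1 hz⟩
    _ = volume H * volume G := by rw [Measure.volume_eq_prod, Measure.prod_prod]
    _ ≤ ENNReal.ofReal s * ENNReal.ofReal s := mul_le_mul' hH hG
    _ = ENNReal.ofReal t := by rw [← ENNReal.ofReal_mul hs.le, ← sq, hst]

end
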